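/- (Analogue of the Liénard–Chipart criterion.) Let p(z) = a_0 z^n + a_1 z^{n−1} + ⋯ + a_n be a real polynomial of degree n ≥ 1 with a_0 > 0. Then p is self-interlacing of kind I if and only if (−1)^j Δ_{2j−1}(p) > 0 for j = 1, …, ⌊(n+1)/2⌋ and (−1)^j a_{2j} > 0 for j = 1, …, ⌊n/2⌋. -/

import Mathlib

open Polynomial

/-- A real polynomial `p` is *self-interlacing of kind I* if all of its `natDegree` roots
are real and simple and, listed in order of decreasing absolute value `λ₀, λ₁, …`,
they satisfy `λ₀ > -λ₁ > λ₂ > -λ₃ > ⋯ > 0`. -/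
def SelfInterlacingI (p : Polynomial ℝ) : Prop :=
  ∃ lam : Fin p.natDegree → ℝ,
    (p = Polynomial.C p.leadingCoeff *
        ∏ i : Fin p.natDegree, (Polynomial.X - Polynomial.C (lam i))) ∧
    StrictAnti (fun i : Fin p.natDegree => (-1 : ℝ) ^ (i : ℕ) * lam i) ∧
    ∀ i : Fin p.natDegree, 0 < (-1 : ℝ) ^ (i : ℕ) * lam i
/-- The coefficient `a_m` of `z^(n-m)` in `p` (where `n = p.natDegree`), with the
convention `a_m = 0` for `m < 0` or `m > n`. -/
noncomputable def aCoeff (p : Polynomial ℝ) (m : ℤ) : ℝ :=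
  if 0 ≤ m ∧ m ≤ (p.natDegree : ℤ) then p.coeff (p.natDegree - m.toNat) else 0

/-- The `k`-th Hurwitz minor `Δ_k(p) = det[(a_{2j-i})]` with `i, j` running over `1, …, k`;
`Δ_0(p) = 1` (determinant of the empty matrix). -/
noncomputable def hurwitzMinor (p : Polynomial ℝ) (k : ℕ) : ℝ :=
  Matrix.det (Matrix.of fun i j : Fin k =>
    aCoeff p (2 * ((j : ℤ) + 1) - ((i : ℤ) + 1)))

/-- Entries of the matrices obtained from a reduced Hurwitz matrix by successively removing its
first column together with the unit row supported there. -/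
def reducedHurwitzEntry (s : ℕ → ℝ) (m i c : ℕ) : ℝ :=
  if i ≤ m then s (m - i + c)
  else if Even (i - m) then (if (i - m) / 2 ≤ c then s (c - (i - m) / 2) else 0)
  else if c = (i - m) / 2 then 1 else 0

theorem reducedHurwitzEntry_succ_right (s : ℕ → ℝ) {m i : ℕ} (h : i < m + 1) (c : ℕ) :
    reducedHurwitzEntry s m i (c + 1) = reducedHurwitzEntry s (m + 1) i c := by
  unfold reducedHurwitzEntry
  rw [if_pos (by omega), if_pos (by omega)]
  congr 1
  omega

theorem reducedHurwitzEntry_succ_succ (s : ℕ → ℝ) {m i : ℕ} (h : m + 1 ≤ i) (c : ℕ) :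
    reducedHurwitzEntry s m (i + 1) (c + 1) = reducedHurwitzEntry s (m + 1) i c := by
  obtain ⟨k, rfl⟩ := Nat.exists_eq_add_of_le h
  unfold reducedHurwitzEntry
  have e1 : m + 1 + k + 1 - m = k + 2 := by omega
  have e2 : (k + 2) / 2 = k / 2 + 1 := by omega
  rw [if_neg (by omega), e1, e2, Nat.add_sub_cancel_left]
  have e3 : Even (k + 2) ↔ Even k := by simp [Nat.even_add]
  simp only [e3, Nat.add_sub_add_right, add_le_add_iff_right, add_left_inj]
  rcases Nat.eq_zero_or_pos k with rfl | hk
  · simp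
  · rw [if_neg (show ¬ m + 1 + k ≤ m + 1 by omega)]

theorem det_reducedHurwitz_succ (s : ℕ → ℝ) (m L : ℕ) (h : m + 1 ≤ L) :
    Matrix.det (Matrix.of fun i c : Fin (L + 1) => reducedHurwitzEntry s m i c) =
      (-1) ^ (m + 1) * Matrix.det (Matrix.of fun i c : Fin L =>
        reducedHurwitzEntry s (m + 1) i c) := by
  rw [Matrix.det_succ_row _ (⟨m + 1, by omega⟩ : Fin (L + 1)),
    Finset.sum_eq_single (0 : Fin (L + 1))]
  · have h1 : reducedHurwitzEntry s m (m + 1) 0 = 1 := by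
      simp [reducedHurwitzEntry]
    simp only [Matrix.of_apply, Fin.val_zero, add_zero, h1, mul_one]
    congr 2
    ext i c
    simp only [Matrix.submatrix_apply, Matrix.of_apply, Fin.succAbove_zero, Fin.val_succ]
    rcases lt_or_ge (i : ℕ) (m + 1) with hi | hi
    · rw [Fin.succAbove_of_castSucc_lt _ _ (by simpa [Fin.lt_def] using hi)]
      exact reducedHurwitzEntry_succ_right s hi c
    · rw [Fin.succAbove_of_le_castSucc _ _ (by simpa [Fin.le_def] using hi)]
      exact reducedHurwitzEntry_succ_succ s hi c
  · intro b _ hb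
    have : (b : ℕ) ≠ 0 := fun h0 => hb (Fin.ext h0)
    simp [reducedHurwitzEntry, this]
  · simp

theorem det_reducedHurwitz_eq (s : ℕ → ℝ) (m L k : ℕ) (h : m + k ≤ L) :
    Matrix.det (Matrix.of fun i c : Fin (L + k) => reducedHurwitzEntry s m i c) =
      (∏ t ∈ Finset.range k, (-1 : ℝ) ^ (m + t + 1)) *
        Matrix.det (Matrix.of fun i c : Fin L => reducedHurwitzEntry s (m + k) i c) := by
  induction k generalizing m with
  | zero => simp
  | succ k ih =>
    have h1 := det_reducedHurwitz_succ s m (L + k) (by omega)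
    rw [← add_assoc, h1, ih (m + 1) (by omega), Finset.prod_range_succ']
    rw [show m + 1 + k = m + (k + 1) by omega]
    simp only [show ∀ t, m + 1 + t + 1 = m + (t + 1) + 1 by intro t; omega, add_zero]
    ring

theorem sign_finRevPerm (k : ℕ) :
    ((Equiv.Perm.sign (Fin.revPerm : Equiv.Perm (Fin (k + 1))) : ℤ) : ℝ) =
      ∏ t ∈ Finset.range k, (-1 : ℝ) ^ (t + 1) := by
  have key : ∀ k : ℕ, Matrix.det (Matrix.of fun i c : Fin (k + 1) =>
      if (i : ℕ) + c = k then (1 : ℝ) else 0) = ∏ t ∈ Finset.range k, (-1 : ℝ) ^ (t + 1) := by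
    intro k
    induction k with
    | zero => simp
    | succ k ih =>
      rw [Matrix.det_succ_row_zero, Finset.sum_eq_single (Fin.last (k + 1)),
        Finset.prod_range_succ, ← ih]
      · simp only [Fin.val_last, Matrix.of_apply, Fin.val_zero, zero_add, if_true, mul_one]
        rw [mul_comm]
        congr 2
        ext i c
        simp only [Matrix.submatrix_apply, Matrix.of_apply, Fin.succAbove_last, Fin.val_succ,
          Fin.val_castSucc]
        congr 1
        apply propext
        omega
      · intro b _ hb
        have : (b : ℕ) ≠ k + 1 := fun h0 => hb (Fin.ext h0)
        simp [this]
      · simp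
  rw [← key]
  have h := Matrix.det_permute (Fin.revPerm : Equiv.Perm (Fin (k + 1)))
    (1 : Matrix (Fin (k + 1)) (Fin (k + 1)) ℝ)
  rw [Matrix.det_one, mul_one] at h
  rw [← h]
  congr 1
  ext i c
  simp only [Matrix.submatrix_apply, Matrix.of_apply, Fin.revPerm_apply, id, Matrix.one_apply,
    Fin.ext_iff, Fin.val_rev]
  congr 1
  apply propext
  omega

theorem det_reducedHurwitz_eq_hankel (s : ℕ → ℝ) (k : ℕ) :
    Matrix.det (Matrix.of fun i c : Fin (k + 1 + k) => reducedHurwitzEntry s 0 i c) =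
      Matrix.det (Matrix.of fun i c : Fin (k + 1) => s (i + c)) := by
  rw [det_reducedHurwitz_eq s 0 (k + 1) k (by omega)]
  have h1 : (Matrix.of fun i c : Fin (k + 1) => reducedHurwitzEntry s (0 + k) i c) =
      (Matrix.of fun i c : Fin (k + 1) => s (i + c)).submatrix Fin.revPerm id := by
    ext i c
    simp only [Matrix.submatrix_apply, Matrix.of_apply, Fin.revPerm_apply, id,
      reducedHurwitzEntry, Fin.val_rev]
    rw [if_pos (by omega)]
    congr 1
    omega
  rw [h1, Matrix.det_permute, sign_finRevPerm]
  simp only [zero_add]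
  rw [← mul_assoc, ← Finset.prod_mul_distrib, Finset.prod_eq_one, one_mul]
  intro t _
  rw [← mul_pow]
  simp

/-- The odd-order Hurwitz-type determinants built from two sequences `φ` and `γ = s * φ` are
Hankel determinants of `s`, up to a power of `φ 0`. -/
theorem det_hurwitz_eq_hankel (s φ γ : ℕ → ℝ)
    (hs : ∀ m, ∑ k ∈ Finset.range (m + 1), s k * φ (m - k) = γ m) (k : ℕ)
    (H : ℕ → ℕ → ℝ)
    (hγ : ∀ r c, H (2 * r) c = if r ≤ c then γ (c - r) else 0)
    (hφ : ∀ r c, H (2 * r + 1) c = if r ≤ c then φ (c - r) else 0) :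
    Matrix.det (Matrix.of fun i c : Fin (k + 1 + k) => H i c) =
      φ 0 ^ (k + 1 + k) * Matrix.det (Matrix.of fun i c : Fin (k + 1) => s (i + c)) := by
  have hprod : (Matrix.of fun i c : Fin (k + 1 + k) => H i c) =
      (Matrix.of fun i c : Fin (k + 1 + k) => reducedHurwitzEntry s 0 i c) *
      (Matrix.of fun i c : Fin (k + 1 + k) => if (i : ℕ) ≤ c then φ (c - i) else 0) := by
    ext i c
    simp only [Matrix.mul_apply, Matrix.of_apply]
    rw [Fin.sum_univ_eq_sum_range
      (fun t => reducedHurwitzEntry s 0 i t * if t ≤ (c : ℕ) then φ (c - t) else 0)]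
    have hsub : ∑ t ∈ Finset.range (c + 1), reducedHurwitzEntry s 0 i t * φ (c - t) =
        ∑ t ∈ Finset.range (k + 1 + k),
          reducedHurwitzEntry s 0 i t * if t ≤ (c : ℕ) then φ (c - t) else 0 := by
      have hc : Finset.range ((c : ℕ) + 1) ⊆ Finset.range (k + 1 + k) := by
        simp
      rw [← Finset.sum_subset hc]
      · refine Finset.sum_congr rfl fun t ht => ?_
        rw [if_pos (by simpa [Nat.lt_succ_iff] using ht)]
      · intro t _ ht
        rw [if_neg (by simpa [Nat.lt_succ_iff] using ht), mul_zero]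
    rw [← hsub]
    clear hsub
    rcases Nat.even_or_odd' (i : ℕ) with ⟨r, hr | hr⟩
    · rw [hr, hγ]
      have hent : ∀ t, reducedHurwitzEntry s 0 (2 * r) t = if r ≤ t then s (t - r) else 0 := by
        intro t
        rcases Nat.eq_zero_or_pos r with rfl | hr0
        · simp [reducedHurwitzEntry]
        · unfold reducedHurwitzEntry
          rw [if_neg (by omega), if_pos (by simp)]
          simp
      simp only [hent]
      split_ifs with hrc
      · obtain ⟨d, hd⟩ := Nat.exists_eq_add_of_le hrc
        rw [← hs, hd,
          show r + d + 1 = r + (d + 1) by omega, Nat.add_sub_cancel_left,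
          Finset.sum_range_add _ r, Finset.sum_eq_zero (s := Finset.range r),
          zero_add]
        · simp only [Nat.add_sub_cancel_left, Nat.le_add_right, if_true, Nat.add_sub_add_left]
        · intro t ht
          rw [if_neg (by simpa using ht), zero_mul]
      · rw [Finset.sum_eq_zero]
        intro t ht
        rw [if_neg (by simp only [Finset.mem_range] at ht; omega), zero_mul]
    · rw [hr, hφ]
      have hent : ∀ t, reducedHurwitzEntry s 0 (2 * r + 1) t = if t = r then 1 else 0 := by
        intro t
        unfold reducedHurwitzEntry
        rw [if_neg (by omega), if_neg (by simp), show (2 * r + 1 - 0) / 2 = r by omega]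
      simp only [hent, ite_mul, one_mul, zero_mul, Finset.sum_ite_eq', Finset.mem_range,
        Nat.lt_succ_iff]
  rw [hprod, Matrix.det_mul, det_reducedHurwitz_eq_hankel, mul_comm]
  congr 1
  rw [Matrix.det_of_isUpperTriangular]
  · simp
  · intro i j hij
    have : ¬ (i : ℕ) ≤ j := by
      have : j < i := hij
      omega
    rw [Matrix.of_apply, if_neg this]

theorem posDef_of_forall_det_pos (A : ℕ → ℕ → ℝ) (hA : ∀ i j, A i j = A j i) (N : ℕ)
    (h : ∀ k ≤ N, 0 < Matrix.det (Matrix.of fun i j : Fin k => A i j)) :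
    (Matrix.of fun i j : Fin N => A i j).PosDef := by
  induction N with
  | zero =>
    exact Matrix.PosDef.of_dotProduct_mulVec_pos (by ext i; exact Fin.elim0 i)
      (fun x hx => (hx (Subsingleton.elim _ _)).elim)
  | succ N ih =>
    have hpd := ih fun k hk => h k (by omega)
    have hdet := h (N + 1) le_rfl
    set A₀ : Matrix (Fin N) (Fin N) ℝ := Matrix.of fun i j : Fin N => A i j with hA₀
    set B : Matrix (Fin N) (Fin 1) ℝ := Matrix.of fun i _ => A i N with hB
    set D : Matrix (Fin 1) (Fin 1) ℝ := Matrix.of fun _ _ => A N N with hD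
    have hblock : (Matrix.of fun i j : Fin (N + 1) => A i j).submatrix finSumFinEquiv
        finSumFinEquiv = Matrix.fromBlocks A₀ B B.conjTranspose D := by
      ext i j
      rcases i with i | i <;> rcases j with j | j <;>
        simp [hA₀, hB, hD, hA N]
    have hdet0 : 0 < A₀.det := hpd.det_pos
    have : Invertible A₀ := hpd.isUnit.invertible
    have hdet' : 0 < (Matrix.fromBlocks A₀ B B.conjTranspose D).det := by
      rw [← hblock, Matrix.det_submatrix_equiv_self]; exact hdet
    have hS : 0 < (D - B.conjTranspose * A₀⁻¹ * B).det := by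
      rw [Matrix.det_fromBlocks₁₁, Matrix.invOf_eq_nonsing_inv] at hdet'
      exact (pos_iff_pos_of_mul_pos hdet').mp hdet0
    have hpsd : (Matrix.fromBlocks A₀ B B.conjTranspose D).PosSemidef := by
      rw [Matrix.PosDef.fromBlocks₁₁ B D hpd]
      have hd : (D - B.conjTranspose * A₀⁻¹ * B) =
          Matrix.diagonal fun _ => (D - B.conjTranspose * A₀⁻¹ * B).det := by
        ext i j
        rw [Subsingleton.elim i 0, Subsingleton.elim j 0]
        simp [Matrix.det_unique]
      rw [hd]
      exact Matrix.PosSemidef.diagonal fun _ => hS.le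
    have hpd2 := hpsd.posDef_iff_det_ne_zero.mpr hdet'.ne'
    rw [← hblock] at hpd2
    have h3 := hpd2.submatrix (e := (finSumFinEquiv (m := N) (n := 1)).symm)
      (Equiv.injective _)
    simpa [Matrix.submatrix_submatrix] using h3

/-- The linear functional on polynomials with moments `s k`. -/
noncomputable def momentFunctional (s : ℕ → ℝ) : ℝ[X] →ₗ[ℝ] ℝ :=
  Polynomial.lsum fun k => s k • LinearMap.id

/-- The polynomial `a 0 * X ^ N + a 1 * X ^ (N - 1) + ⋯ + a N`. -/
noncomputable def descPoly (a : ℕ → ℝ) (N : ℕ) : ℝ[X] :=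
  ∑ k ∈ Finset.range (N + 1), monomial (N - k) (a k)

theorem momentFunctional_monomial (s : ℕ → ℝ) (k : ℕ) (a : ℝ) :
    momentFunctional s (monomial k a) = s k * a := by
  simp [momentFunctional, Polynomial.lsum_apply]

theorem momentFunctional_C_mul (s : ℕ → ℝ) (a : ℝ) (h : ℝ[X]) :
    momentFunctional s (C a * h) = a * momentFunctional s h := by
  rw [← smul_eq_C_mul, map_smul, smul_eq_mul]

theorem coeff_descPoly (a : ℕ → ℝ) {N k : ℕ} (hk : k ≤ N) :
    (descPoly a N).coeff (N - k) = a k := by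
  unfold descPoly
  rw [finsetSum_coeff, Finset.sum_eq_single k]
  · simp
  · intro b hb hbk
    rw [coeff_monomial, if_neg]
    simp only [Finset.mem_range] at hb
    omega
  · intro h
    simp only [Finset.mem_range] at h
    omega

theorem natDegree_descPoly_le (a : ℕ → ℝ) (N : ℕ) : (descPoly a N).natDegree ≤ N :=
  natDegree_sum_le_of_forall_le _ _ fun _ _ =>
    (natDegree_monomial_le _).trans (Nat.sub_le _ _)

theorem natDegree_descPoly {a : ℕ → ℝ} (ha : a 0 ≠ 0) (N : ℕ) : (descPoly a N).natDegree = N :=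
  natDegree_eq_of_le_of_coeff_ne_zero (natDegree_descPoly_le a N) <| by
    have h := coeff_descPoly a (Nat.zero_le N)
    rw [Nat.sub_zero] at h
    rwa [h]

theorem eval_descPoly (a : ℕ → ℝ) (N : ℕ) (t : ℝ) :
    (descPoly a N).eval t = ∑ k ∈ Finset.range (N + 1), a k * t ^ (N - k) := by
  simp [descPoly, eval_finsetSum]

section Moments

variable {s φ γ : ℕ → ℝ} {N : ℕ}

theorem momentFunctional_mul_descPoly
    (hs : ∀ m, ∑ k ∈ Finset.range (m + 1), s k * φ (m - k) = γ m)
    (hφ : ∀ k, N < k → φ k = 0) (hγ : ∀ k, N ≤ k → γ k = 0) (h : ℝ[X]) :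
    momentFunctional s (h * descPoly φ N) = 0 := by
  induction h using Polynomial.induction_on' with
  | add p q hp hq => rw [add_mul, map_add, hp, hq, add_zero]
  | monomial m a =>
    have h1 : momentFunctional s (monomial m a * descPoly φ N) =
        a * ∑ k ∈ Finset.range (N + 1), s (m + (N - k)) * φ k := by
      simp only [descPoly, Finset.mul_sum, map_sum, monomial_mul_monomial,
        momentFunctional_monomial]
      exact Finset.sum_congr rfl fun k _ => by ring
    rw [h1, ← Finset.sum_range_reflect]
    have h2 := hs (m + N)
    rw [hγ _ (by omega), add_assoc, Finset.sum_range_add _ m, Finset.sum_eq_zero, zero_add] at h2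
    · rw [← mul_zero a, ← h2]
      congr 1
      refine Finset.sum_congr rfl fun k hk => ?_
      simp only [Finset.mem_range] at hk
      congr 2 <;> omega
    · intro k hk
      simp only [Finset.mem_range] at hk
      rw [hφ _ (by omega), mul_zero]

theorem momentFunctional_quotient
    (hs : ∀ m, ∑ k ∈ Finset.range (m + 1), s k * φ (m - k) = γ m)
    {t : ℝ} {q : ℝ[X]} (hφ0 : φ 0 ≠ 0)
    (hq : descPoly φ (N + 1) = (X - C t) * q) :
    momentFunctional s q = (descPoly γ N).eval t := by
  have hqdeg : q.natDegree = N := by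
    have h1 := natDegree_descPoly hφ0 (N + 1)
    have hq0 : q ≠ 0 := by
      rintro rfl
      simp [hq] at h1
    rw [hq, natDegree_mul (X_sub_C_ne_zero t) hq0, natDegree_X_sub_C] at h1
    omega
  set κ : ℕ → ℝ := fun k => q.coeff (N - k) with hκ
  have hκ0 : φ 0 = κ 0 := by
    have := coeff_descPoly φ (Nat.zero_le (N + 1))
    rw [← this, hq, sub_mul, coeff_sub]
    simp [hκ, coeff_X_mul, coeff_eq_zero_of_natDegree_lt (p := q) (n := N + 1) (by omega)]
  have hκs : ∀ k, k + 1 ≤ N → φ (k + 1) = κ (k + 1) - t * κ k := by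
    intro k hk
    have := coeff_descPoly φ (show k + 1 ≤ N + 1 by omega)
    rw [← this, hq, sub_mul, coeff_sub, show N + 1 - (k + 1) = (N - (k + 1)) + 1 by omega,
      coeff_X_mul, coeff_C_mul, show N - (k + 1) + 1 = N - k by omega]
  have hv : ∀ m ≤ N, ∑ k ∈ Finset.range (m + 1), s k * κ (m - k) =
      ∑ k ∈ Finset.range (m + 1), γ k * t ^ (m - k) := by
    intro m
    induction m with
    | zero =>
      intro _
      simp [← hs 0, hκ0]
    | succ m ih =>
      intro hm
      have ih' := ih (by omega)
      have e : ∑ k ∈ Finset.range (m + 1), s k * φ (m + 1 - k) =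
          ∑ k ∈ Finset.range (m + 1), s k * κ (m + 1 - k) -
            t * ∑ k ∈ Finset.range (m + 1), s k * κ (m - k) := by
        rw [Finset.mul_sum, ← Finset.sum_sub_distrib]
        refine Finset.sum_congr rfl fun k hk => ?_
        simp only [Finset.mem_range] at hk
        rw [show m + 1 - k = (m - k) + 1 by omega, hκs _ (by omega)]
        ring
      have h2 := hs (m + 1)
      rw [Finset.sum_range_succ, e, ih', Nat.sub_self, hκ0] at h2
      rw [Finset.sum_range_succ, Finset.sum_range_succ _ (m + 1), ← h2, Nat.sub_self,
        Finset.mul_sum, pow_zero]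
      have e3 : ∑ k ∈ Finset.range (m + 1), γ k * t ^ (m + 1 - k) =
          ∑ k ∈ Finset.range (m + 1), t * (γ k * t ^ (m - k)) := by
        refine Finset.sum_congr rfl fun k hk => ?_
        simp only [Finset.mem_range] at hk
        rw [show m + 1 - k = (m - k) + 1 by omega]
        ring
      rw [e3]
      ring
  rw [eval_descPoly, ← hv N le_rfl]
  conv_lhs => rw [q.as_sum_range' (N + 1) (by omega)]
  rw [map_sum]
  refine Finset.sum_congr rfl fun k hk => ?_
  simp only [Finset.mem_range] at hk
  rw [momentFunctional_monomial, hκ]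
  simp only
  rw [show N - (N - k) = k by omega]

theorem momentFunctional_mul_quotient
    (hs : ∀ m, ∑ k ∈ Finset.range (m + 1), s k * φ (m - k) = γ m)
    (hφ : ∀ k, N + 1 < k → φ k = 0) (hγ : ∀ k, N + 1 ≤ k → γ k = 0) (hφ0 : φ 0 ≠ 0)
    {t : ℝ} {q : ℝ[X]} (hq : descPoly φ (N + 1) = (X - C t) * q) (h : ℝ[X]) :
    momentFunctional s (h * q) = h.eval t * (descPoly γ N).eval t := by
  obtain ⟨k, hk⟩ := X_sub_C_dvd_sub_C_eval (a := t) (p := h)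
  have h1 : h * q = C (h.eval t) * q + k * descPoly φ (N + 1) := by
    rw [hq]
    linear_combination q * hk
  rw [h1, map_add, momentFunctional_mul_descPoly hs hφ hγ, momentFunctional_C_mul,
    momentFunctional_quotient hs hφ0 hq, add_zero]

end Moments

/-- If `L` is given by point evaluations at distinct nodes with negative weights, then it is
negative on nonzero squares of small degree. -/
theorem map_mul_self_neg_of_weights (L : ℝ[X] →ₗ[ℝ] ℝ) {F G : ℝ[X]} {a : ℝ} {N : ℕ} {u : ℕ → ℝ}
    (hu : Set.InjOn u (Finset.range N))
    (hF : F = C a * ∏ i ∈ Finset.range N, (X - C (u i)))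
    (hL : ∀ t q, F = (X - C t) * q → ∀ h, L (h * q) = h.eval t * G.eval t)
    (hneg : ∀ i < N, (a * ∏ j ∈ (Finset.range N).erase i, (u i - u j)) * G.eval (u i) < 0)
    {Q : ℝ[X]} (hQ0 : Q ≠ 0) (hQ : Q.degree < N) : L (Q * Q) < 0 := by
  have hbasis : ∀ i ∈ Finset.range N, L (Q * Lagrange.basis (Finset.range N) u i) =
      Q.eval (u i) * ((a * ∏ j ∈ (Finset.range N).erase i, (u i - u j))⁻¹ * G.eval (u i)) := by
    intro i hi
    set q := C a * ∏ j ∈ (Finset.range N).erase i, (X - C (u j)) with hq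
    have hFq : F = (X - C (u i)) * q := by
      rw [hF, hq, ← Finset.mul_prod_erase _ _ hi]
      ring
    have hc := hneg i (Finset.mem_range.mp hi)
    have hc0 : a * ∏ j ∈ (Finset.range N).erase i, (u i - u j) ≠ 0 := by
      intro h
      rw [h, zero_mul] at hc
      exact lt_irrefl _ hc
    have hb : Lagrange.basis (Finset.range N) u i =
        C (a * ∏ j ∈ (Finset.range N).erase i, (u i - u j))⁻¹ * q := by
      have ha : a ≠ 0 := left_ne_zero_of_mul hc0
      simp only [Lagrange.basis, Lagrange.basisDivisor, hq, Finset.prod_mul_distrib]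
      rw [← map_prod, Finset.prod_inv_distrib, mul_inv, ← mul_assoc, ← C_mul,
        mul_right_comm, inv_mul_cancel₀ ha, one_mul]
    rw [hb, show Q * (C (a * ∏ j ∈ (Finset.range N).erase i, (u i - u j))⁻¹ * q) =
      (a * ∏ j ∈ (Finset.range N).erase i, (u i - u j))⁻¹ • (Q * q) by
        rw [smul_eq_C_mul]; ring, map_smul, hL _ _ hFq, smul_eq_mul]
    ring
  have hinterp : Q = ∑ i ∈ Finset.range N,
      C (Q.eval (u i)) * Lagrange.basis (Finset.range N) u i := by
    have := Lagrange.eq_interpolate hu (f := Q) (by simpa using hQ)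
    rw [Lagrange.interpolate_apply] at this
    exact this
  have hsum : L (Q * Q) = ∑ i ∈ Finset.range N, Q.eval (u i) ^ 2 *
      ((a * ∏ j ∈ (Finset.range N).erase i, (u i - u j))⁻¹ * G.eval (u i)) := by
    conv_lhs => rw [congrArg (Q * ·) hinterp]
    simp only [Finset.mul_sum]
    rw [map_sum]
    refine Finset.sum_congr rfl fun i hi => ?_
    rw [show Q * (C (Q.eval (u i)) * Lagrange.basis (Finset.range N) u i) =
      Q.eval (u i) • (Q * Lagrange.basis (Finset.range N) u i) by
        rw [smul_eq_C_mul]; ring, map_smul, hbasis i hi, smul_eq_mul]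
    ring
  have hw : ∀ i < N,
      (a * ∏ j ∈ (Finset.range N).erase i, (u i - u j))⁻¹ * G.eval (u i) < 0 := by
    intro i hi
    have := hneg i hi
    rcases mul_neg_iff.mp this with h | h
    · exact mul_neg_of_pos_of_neg (inv_pos.mpr h.1) h.2
    · exact mul_neg_of_neg_of_pos (inv_lt_zero.mpr h.1) h.2
  obtain ⟨i, hi, hQi⟩ : ∃ i ∈ Finset.range N, Q.eval (u i) ≠ 0 := by
    by_contra! hall
    exact hQ0 (by rw [hinterp]; exact Finset.sum_eq_zero fun i hi => by rw [hall i hi]; simp)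
  rw [hsum]
  refine Finset.sum_neg' (fun j hj => ?_) ⟨i, hi, ?_⟩
  · exact mul_nonpos_of_nonneg_of_nonpos (sq_nonneg _) (hw j (Finset.mem_range.mp hj)).le
  · exact mul_neg_of_pos_of_neg (by positivity) (hw i (Finset.mem_range.mp hi))

section NegativeOnSquares

variable (L : ℝ[X] →ₗ[ℝ] ℝ) {F : ℝ[X]}

theorem splits_of_map_mul_self_neg (hF0 : F ≠ 0) (hLF : ∀ h, L (h * F) = 0)
    (hneg : ∀ Q : ℝ[X], Q ≠ 0 → Q.natDegree < F.natDegree → L (Q * Q) < 0) : F.Splits := by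
  refine Splits.of_splits_map (algebraMap ℝ ℂ) (IsAlgClosed.splits _) fun z hz => ?_
  by_cases him : z.im = 0
  · exact ⟨z.re, Complex.ext rfl (by simp [him])⟩
  exfalso
  have hz0 : aeval z F = 0 := by
    have := (mem_roots'.mp hz).2
    rwa [IsRoot, eval_map_algebraMap] at this
  obtain ⟨q, hq⟩ := quadratic_dvd_of_aeval_eq_zero_im_ne_zero F hz0 him
  have hquad : X ^ 2 - C (2 * z.re) * X + C (‖z‖ ^ 2) =
      (X - C z.re) ^ 2 + C (z.im ^ 2) := by
    rw [← Complex.normSq_eq_norm_sq, Complex.normSq_apply]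
    simp only [C_add, C_mul, C_pow, map_ofNat]
    ring
  rw [hquad] at hq
  have hq0 : q ≠ 0 := by
    rintro rfl
    exact hF0 (by simpa using hq)
  have hdeg2 : ((X - C z.re) ^ 2 + C (z.im ^ 2) : ℝ[X]).natDegree = 2 := by
    rw [natDegree_add_C, natDegree_pow, natDegree_X_sub_C]
  have hd0 : ((X - C z.re) ^ 2 + C (z.im ^ 2) : ℝ[X]) ≠ 0 := by
    intro h
    rw [h] at hdeg2
    simp at hdeg2
  have hFdeg : F.natDegree = 2 + q.natDegree := by
    rw [hq, natDegree_mul hd0 hq0, hdeg2]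
  have hne : (X - C z.re) * q ≠ 0 := mul_ne_zero (X_sub_C_ne_zero _) hq0
  have h1 := hneg q hq0 (by omega)
  have h2 := hneg ((X - C z.re) * q) hne (by
    rw [natDegree_mul (X_sub_C_ne_zero _) hq0, natDegree_X_sub_C]
    omega)
  have h3 := hLF q
  rw [show q * F = ((X - C z.re) * q) * ((X - C z.re) * q) + (z.im ^ 2) • (q * q) by
    rw [hq, smul_eq_C_mul]; ring, map_add, map_smul, smul_eq_mul] at h3
  nlinarith [mul_nonneg (sq_nonneg z.im) (neg_nonneg.mpr h1.le)]

theorem nodup_roots_of_map_mul_self_neg (hF0 : F ≠ 0) (hLF : ∀ h, L (h * F) = 0)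
    (hneg : ∀ Q : ℝ[X], Q ≠ 0 → Q.natDegree < F.natDegree → L (Q * Q) < 0) : F.roots.Nodup := by
  rw [Multiset.nodup_iff_count_le_one]
  intro t
  by_contra! hcount
  rw [count_roots, Nat.lt_iff_add_one_le, le_rootMultiplicity_iff hF0] at hcount
  obtain ⟨q, hq⟩ := hcount
  have hq0 : q ≠ 0 := by
    rintro rfl
    exact hF0 (by simpa using hq)
  have hFdeg : F.natDegree = 2 + q.natDegree := by
    rw [hq, natDegree_mul (pow_ne_zero _ (X_sub_C_ne_zero t)) hq0, natDegree_pow,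
      natDegree_X_sub_C]
  have h2 := hneg ((X - C t) * q) (mul_ne_zero (X_sub_C_ne_zero _) hq0) (by
    rw [natDegree_mul (X_sub_C_ne_zero _) hq0, natDegree_X_sub_C]
    omega)
  have h3 := hLF q
  rw [show q * F = ((X - C t) * q) * ((X - C t) * q) by rw [hq]; ring] at h3
  exact h2.ne h3

end NegativeOnSquares

theorem neg_one_pow_two_mul_add_one (k : ℕ) : (-1 : ℝ) ^ (2 * k + 1) = -1 := by
  rw [pow_succ, pow_mul, neg_one_sq, one_pow, one_mul]

theorem prod_sign_pos {ι : Type*} [DecidableEq ι] {S T : Finset ι} (hTS : T ⊆ S) {f : ι → ℝ}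
    (hT : ∀ i ∈ T, f i < 0) (hS : ∀ i ∈ S, i ∉ T → 0 < f i) :
    0 < (-1 : ℝ) ^ T.card * ∏ i ∈ S, f i := by
  rw [← Finset.prod_sdiff hTS, mul_left_comm, ← Finset.prod_neg]
  refine mul_pos (Finset.prod_pos fun i hi => ?_) (Finset.prod_pos fun i hi => ?_)
  · rw [Finset.mem_sdiff] at hi
    exact hS i hi.1 hi.2
  · exact neg_pos.mpr (hT i hi)

theorem exists_zero_of_sign_change {f : ℝ → ℝ} (hf : Continuous f) {a b : ℝ} (hab : a < b)
    (k : ℕ) (ha : 0 < (-1 : ℝ) ^ (k + 1) * f a) (hb : 0 < (-1 : ℝ) ^ k * f b) :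
    ∃ c, a < c ∧ c < b ∧ f c = 0 := by
  have h := intermediate_value_Ioo hab.le
    (f := fun x => (-1 : ℝ) ^ k * f x) (by fun_prop)
  have h0 : (0 : ℝ) ∈ Set.Ioo ((-1 : ℝ) ^ k * f a) ((-1 : ℝ) ^ k * f b) := by
    refine ⟨?_, hb⟩
    rw [pow_succ] at ha
    linarith
  obtain ⟨c, hc, hc0⟩ := h h0
  exact ⟨c, hc.1, hc.2, by simpa using hc0⟩

theorem eq_C_mul_prod_of_roots {F : ℝ[X]} {N : ℕ} {a : ℝ} (ha : a ≠ 0) (hdeg : F.natDegree = N)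
    (hlead : F.leadingCoeff = a) {u : ℕ → ℝ} (hu : Set.InjOn u (Finset.range N))
    (hroot : ∀ i < N, F.eval (u i) = 0) :
    F = C a * ∏ i ∈ Finset.range N, (X - C (u i)) := by
  have hF0 : F ≠ 0 := by
    rintro rfl
    exact ha (by simpa using hlead.symm)
  have hm : (∏ i ∈ Finset.range N, (X - C (u i))).Monic := monic_prod_X_sub_C _ _
  have hmd : (∏ i ∈ Finset.range N, (X - C (u i))).degree = (N : WithBot ℕ) := by
    rw [degree_prod]
    simp
  have hd : F.degree = (C a * ∏ i ∈ Finset.range N, (X - C (u i))).degree := by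
    rw [degree_C_mul ha, hmd, degree_eq_natDegree hF0, hdeg]
  refine eq_of_degree_sub_lt_of_eval_index_eq (Finset.range N) hu ?_ ?_
  · refine (degree_sub_lt_left hd hF0 ?_).trans_eq ?_
    · rw [leadingCoeff_mul, leadingCoeff_C, hm.leadingCoeff, hlead, mul_one]
    · rw [hd, degree_C_mul ha, hmd, Finset.card_range]
  · intro i hi
    rw [hroot i (Finset.mem_range.mp hi), eval_mul, eval_prod, Finset.prod_eq_zero hi (by simp),
      mul_zero]

theorem lt_of_succ_lt_of_lt {f : ℕ → ℝ} {n : ℕ} (h : ∀ k, k + 1 < n → f (k + 1) < f k) {i j : ℕ}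
    (hij : i < j) (hj : j < n) : f j < f i := by
  induction j, hij using Nat.le_induction with
  | base => exact h i hj
  | succ k _ ih => exact (h k hj).trans (ih (by omega))

section EvenOddParts

variable {p F G : ℝ[X]} {n : ℕ}

/-- The roots of the even part of a self-interlacing polynomial separate the absolute values of
its roots, and the odd part alternates in sign there. -/
theorem SelfInterlacingI.exists_nodes (hdeg : p.natDegree = n) (hlead : 0 < p.leadingCoeff)
    (hA : ∀ x : ℝ, x ^ (2 * ((n + 1) / 2) - n) * p.eval x = F.eval (x ^ 2) + x * G.eval (x ^ 2))
    (hB : ∀ x : ℝ, x ^ (2 * ((n + 1) / 2) - n) * ((-1) ^ n * p.eval (-x)) =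
      F.eval (x ^ 2) - x * G.eval (x ^ 2))
    (h0 : n / 2 < (n + 1) / 2 → p.eval 0 = G.eval 0) (h : SelfInterlacingI p) :
    ∃ x : ℕ → ℝ, x (n / 2) = 0 ∧ (∀ i < n / 2, x (i + 1) < x i) ∧
      ∀ i < (n + 1) / 2, F.eval (x i ^ 2) = 0 ∧ 0 < (-1 : ℝ) ^ (i + 1) * G.eval (x i ^ 2) := by
  subst hdeg
  set n := p.natDegree with hn
  obtain ⟨lam, hp, hanti, hpos⟩ := h
  set V : ℕ → ℝ := fun i => if h : i < n then (-1 : ℝ) ^ i * lam ⟨i, h⟩ else 0 with hV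
  have hVpos : ∀ i < n, 0 < V i := by
    intro i hi
    simp only [hV, dif_pos hi]
    exact hpos ⟨i, hi⟩
  have hVnonneg : ∀ i, 0 ≤ V i := by
    intro i
    rcases lt_or_ge i n with hi | hi
    · exact (hVpos i hi).le
    · simp [hV, hi.not_gt]
  have hVanti : ∀ i j, i < n → i < j → V j < V i := by
    intro i j hi hij
    rcases lt_or_ge j n with hj | hj
    · simp only [hV, dif_pos hi, dif_pos hj]
      exact hanti (show (⟨i, hi⟩ : Fin n) < ⟨j, hj⟩ from hij)
    · have : V j = 0 := by simp [hV, hj.not_gt]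
      rw [this]
      exact hVpos i hi
  have hVanti' : ∀ i j, i < n → i ≤ j → V j ≤ V i := by
    intro i j hi hij
    rcases eq_or_lt_of_le hij with rfl | hij
    · exact le_rfl
    · exact (hVanti i j hi hij).le
  have hpe : ∀ x, p.eval x =
      p.leadingCoeff * ∏ i ∈ Finset.range n, (x - (-1) ^ i * V i) := by
    intro x
    conv_lhs => rw [hp]
    rw [eval_mul, eval_C, eval_prod, ← Fin.prod_univ_eq_prod_range]
    congr 1
    refine Finset.prod_congr rfl fun i _ => ?_
    simp [hV, ← mul_assoc, ← mul_pow]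
  have hpe' : ∀ x, (-1) ^ n * p.eval (-x) =
      p.leadingCoeff * ∏ i ∈ Finset.range n, (x + (-1) ^ i * V i) := by
    intro x
    rw [hpe, mul_left_comm]
    congr 1
    have hc : (-1 : ℝ) ^ n = (-1) ^ (Finset.range n).card := by simp
    rw [hc, ← Finset.prod_neg]
    exact Finset.prod_congr rfl fun i _ => by ring
  have sign1 : ∀ m < (n + 1) / 2, ∀ x, 0 ≤ x → (2 * m + 2 < n → V (2 * m + 2) < x) →
      x < V (2 * m) → 0 < (-1 : ℝ) ^ (m + 1) * p.eval x := by
    intro m hm x hx hx1 hx2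
    have hT : (Finset.range (m + 1)).image (fun k => 2 * k) ⊆ Finset.range n := by
      intro i hi
      simp only [Finset.mem_image, Finset.mem_range] at hi ⊢
      omega
    have hcard : ((Finset.range (m + 1)).image (fun k => 2 * k)).card = m + 1 := by
      rw [Finset.card_image_of_injective _ fun a b hab => by simpa using hab, Finset.card_range]
    have h1 := prod_sign_pos hT (f := fun i => x - (-1) ^ i * V i) (fun i hi => by
      simp only [Finset.mem_image, Finset.mem_range] at hi
      obtain ⟨k, hk, rfl⟩ := hi
      have := hVanti' (2 * k) (2 * m) (by omega) (by omega)
      simp only [pow_mul, neg_one_sq, one_pow, one_mul]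
      linarith) (fun i hi hiT => by
      simp only [Finset.mem_image, Finset.mem_range, not_exists, not_and] at hi hiT
      rcases Nat.even_or_odd' i with ⟨k, rfl | rfl⟩
      · have hk : m + 1 ≤ k := by
          by_contra hk
          exact hiT k (by omega) rfl
        have h2 := hx1 (by omega)
        have h3 := hVanti' (2 * m + 2) (2 * k) (by omega) (by omega)
        simp only [pow_mul, neg_one_sq, one_pow, one_mul]
        linarith
      · have h2 := hVpos _ hi
        simp only [neg_one_pow_two_mul_add_one, one_mul, neg_mul]
        linarith)
    rw [hcard] at h1
    rw [hpe, mul_left_comm]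
    exact mul_pos hlead h1
  have sign2 : ∀ m < (n + 1) / 2, ∀ x, 0 ≤ x → V (2 * m + 1) < x →
      (∀ k < m, x < V (2 * k + 1)) → 0 < (-1 : ℝ) ^ m * ((-1) ^ n * p.eval (-x)) := by
    intro m hm x hx hx1 hx2
    have hT : (Finset.range m).image (fun k => 2 * k + 1) ⊆ Finset.range n := by
      intro i hi
      simp only [Finset.mem_image, Finset.mem_range] at hi ⊢
      omega
    have hcard : ((Finset.range m).image (fun k => 2 * k + 1)).card = m := by
      rw [Finset.card_image_of_injective _ fun a b hab => by simpa using hab, Finset.card_range]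
    have h1 := prod_sign_pos hT (f := fun i => x + (-1) ^ i * V i) (fun i hi => by
      simp only [Finset.mem_image, Finset.mem_range] at hi
      obtain ⟨k, hk, rfl⟩ := hi
      have := hx2 k hk
      simp only [neg_one_pow_two_mul_add_one, one_mul, neg_mul]
      linarith) (fun i hi hiT => by
      simp only [Finset.mem_image, Finset.mem_range, not_exists, not_and] at hi hiT
      rcases Nat.even_or_odd' i with ⟨k, rfl | rfl⟩
      · have h2 := hVpos _ hi
        simp only [pow_mul, neg_one_sq, one_pow, one_mul]
        linarith
      · have hk : m ≤ k := by
          by_contra hk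
          exact hiT k (by omega) rfl
        have h3 := hVanti' (2 * m + 1) (2 * k + 1) (by omega) (by omega)
        simp only [neg_one_pow_two_mul_add_one, one_mul, neg_mul]
        linarith)
    rw [hcard] at h1
    rw [hpe', mul_left_comm]
    exact mul_pos hlead h1
  have hF1 : ∀ m < (n + 1) / 2, 0 < (-1 : ℝ) ^ m * F.eval (V (2 * m) ^ 2) := by
    intro m hm
    have h1 := sign2 m hm (V (2 * m)) (hVnonneg _) (hVanti _ _ (by omega) (by omega))
      fun k hk => hVanti _ _ (by omega) (by omega)
    have hroot : p.eval (V (2 * m)) = 0 := by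
      rw [hpe, Finset.prod_eq_zero (i := 2 * m) (Finset.mem_range.mpr (by omega)), mul_zero]
      simp [pow_mul]
    have hVp := hVpos (2 * m) (by omega)
    have h2 := hA (V (2 * m))
    have h3 := hB (V (2 * m))
    rw [hroot, mul_zero] at h2
    have h4 := mul_pos (pow_pos hVp (2 * ((n + 1) / 2) - n)) h1
    rw [mul_left_comm, h3] at h4
    rw [show F.eval (V (2 * m) ^ 2) - V (2 * m) * G.eval (V (2 * m) ^ 2) =
      2 * F.eval (V (2 * m) ^ 2) by linarith] at h4
    linarith
  have hF2 : ∀ m < n / 2, 0 < (-1 : ℝ) ^ (m + 1) * F.eval (V (2 * m + 1) ^ 2) := by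
    intro m hm
    have h1 := sign1 m (by omega) (V (2 * m + 1)) (hVnonneg _)
      (fun _ => hVanti _ _ (by omega) (by omega)) (hVanti _ _ (by omega) (by omega))
    have hroot : (-1) ^ n * p.eval (-V (2 * m + 1)) = 0 := by
      rw [hpe', Finset.prod_eq_zero (i := 2 * m + 1) (Finset.mem_range.mpr (by omega)), mul_zero]
      simp [pow_succ, pow_mul]
    have hVp := hVpos (2 * m + 1) (by omega)
    have h2 := hA (V (2 * m + 1))
    have h3 := hB (V (2 * m + 1))
    rw [hroot, mul_zero] at h3
    have h4 := mul_pos (pow_pos hVp (2 * ((n + 1) / 2) - n)) h1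
    rw [mul_left_comm, h2] at h4
    rw [show F.eval (V (2 * m + 1) ^ 2) + V (2 * m + 1) * G.eval (V (2 * m + 1) ^ 2) =
      2 * F.eval (V (2 * m + 1) ^ 2) by linarith] at h4
    linarith
  have hex : ∀ m, ∃ x, (m < n / 2 → V (2 * m + 1) < x ∧ x < V (2 * m) ∧ F.eval (x ^ 2) = 0) ∧
      (n / 2 ≤ m → x = 0) := by
    intro m
    rcases lt_or_ge m (n / 2) with hm | hm
    · obtain ⟨c, h1, h2, h3⟩ := exists_zero_of_sign_change (f := fun x => F.eval (x ^ 2))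
        (by fun_prop) (hVanti (2 * m) (2 * m + 1) (by omega) (by omega)) m (hF2 m hm)
        (hF1 m (by omega))
      exact ⟨c, fun _ => ⟨h1, h2, h3⟩, fun h => absurd hm (by omega)⟩
    · exact ⟨0, fun h => absurd h (by omega), fun _ => rfl⟩
  choose x hx1 hx2 using hex
  refine ⟨x, hx2 _ le_rfl, fun i hi => ?_, fun i hi => ?_⟩
  · obtain ⟨h1, -, -⟩ := hx1 i hi
    rcases lt_or_ge (i + 1) (n / 2) with hi' | hi'
    · obtain ⟨-, h2, -⟩ := hx1 (i + 1) hi'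
      exact (h2.trans (hVanti _ _ (by omega) (by omega))).trans h1
    · rw [hx2 _ hi']
      exact (hVnonneg _).trans_lt h1
  · rcases lt_or_ge i (n / 2) with hi' | hi'
    · obtain ⟨h1, h2, h3⟩ := hx1 i hi'
      refine ⟨h3, ?_⟩
      have hxp : 0 < x i := (hVnonneg _).trans_lt h1
      have h4 := sign1 i hi (x i) hxp.le
        (fun _ => (hVanti (2 * i + 1) _ (by omega) (by omega)).trans h1) h2
      have h5 := mul_pos (pow_pos hxp (2 * ((n + 1) / 2) - n)) h4
      rw [mul_left_comm, hA, h3, zero_add, mul_left_comm] at h5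
      exact (pos_iff_pos_of_mul_pos h5).mp hxp
    · have hx0 := hx2 i hi'
      have h4 := sign1 i hi 0 le_rfl (fun h => absurd h (by omega)) (hVpos _ (by omega))
      rw [h0 (by omega)] at h4
      have h5 := hA 0
      rw [show 2 * ((n + 1) / 2) - n = 1 by omega] at h5
      rw [hx0]
      norm_num at h5 ⊢
      exact ⟨h5.symm, h4⟩

/-- If the even part has sufficiently many nonnegative roots and the odd part alternates in sign
there, then the polynomial is self-interlacing. -/
theorem selfInterlacingI_of_nodes (hdeg : p.natDegree = n) (hn : 1 ≤ n)
    (hlead : 0 < p.leadingCoeff) (hFdeg : F.natDegree = (n + 1) / 2) (hFlead : 0 < F.leadingCoeff)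
    (hA : ∀ x : ℝ, x ^ (2 * ((n + 1) / 2) - n) * p.eval x = F.eval (x ^ 2) + x * G.eval (x ^ 2))
    (hB : ∀ x : ℝ, x ^ (2 * ((n + 1) / 2) - n) * ((-1) ^ n * p.eval (-x)) =
      F.eval (x ^ 2) - x * G.eval (x ^ 2))
    (h0 : n / 2 < (n + 1) / 2 → p.eval 0 = G.eval 0)
    {x : ℕ → ℝ} (hx0 : x (n / 2) = 0) (hx : ∀ i < n / 2, x (i + 1) < x i)
    (hFG : ∀ i < (n + 1) / 2, F.eval (x i ^ 2) = 0 ∧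
      0 < (-1 : ℝ) ^ (i + 1) * G.eval (x i ^ 2)) : SelfInterlacingI p := by
  have hxanti : ∀ i j, i < j → j ≤ n / 2 → x j < x i := fun i j hij hj =>
    lt_of_succ_lt_of_lt (n := n / 2 + 1) (fun k hk => hx k (by omega)) hij (by omega)
  have hxpos : ∀ i < n / 2, 0 < x i := fun i hi => hx0 ▸ hxanti i _ hi le_rfl
  have hxnonneg : ∀ i ≤ n / 2, 0 ≤ x i := by
    intro i hi
    rcases eq_or_lt_of_le hi with rfl | hi
    · exact hx0.ge
    · exact (hxpos i hi).le
  have hsq : ∀ i j, i < j → j ≤ n / 2 → x j ^ 2 < x i ^ 2 := fun i j hij hj =>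
    pow_lt_pow_left₀ (hxanti i j hij hj) (hxnonneg j hj) two_ne_zero
  have hinj : Set.InjOn (fun i => x i ^ 2) (Finset.range ((n + 1) / 2)) := by
    intro i hi j hj hij
    simp only [Finset.coe_range, Set.mem_Iio] at hi hj
    by_contra hne
    rcases lt_or_gt_of_ne hne with h | h
    · exact (hsq i j h (by omega)).ne' hij
    · exact (hsq j i h (by omega)).ne hij
  have hF := eq_C_mul_prod_of_roots hFlead.ne' hFdeg rfl hinj fun i hi => (hFG i hi).1
  have hFsign : ∀ i ≤ (n + 1) / 2, ∀ y : ℝ, (∀ j < i, y ^ 2 < x j ^ 2) →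
      (∀ j, i ≤ j → j < (n + 1) / 2 → x j ^ 2 < y ^ 2) →
      0 < (-1 : ℝ) ^ i * F.eval (y ^ 2) := by
    intro i hi y h1 h2
    have h3 := prod_sign_pos (S := Finset.range ((n + 1) / 2)) (T := Finset.range i)
      (by simpa using hi) (f := fun j => y ^ 2 - x j ^ 2)
      (fun j hj => sub_neg.mpr (h1 j (Finset.mem_range.mp hj)))
      (fun j hj hji => sub_pos.mpr
        (h2 j (by simpa using hji) (Finset.mem_range.mp hj)))
    rw [Finset.card_range] at h3
    rw [hF, eval_mul, eval_prod, eval_C, mul_left_comm]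
    exact mul_pos hFlead (by simpa using h3)
  have hSp : ∀ i < (n + 1) / 2, 0 < (-1 : ℝ) ^ (i + 1) * p.eval (x i) := by
    intro i hi
    obtain ⟨h1, h2⟩ := hFG i hi
    rcases lt_or_ge i (n / 2) with hi' | hi'
    · have h3 := hA (x i)
      rw [h1, zero_add] at h3
      have h4 := mul_pos (hxpos i hi') h2
      rw [mul_left_comm, ← h3, mul_left_comm] at h4
      exact (pos_iff_pos_of_mul_pos h4).mp (pow_pos (hxpos i hi') _)
    · obtain rfl : i = n / 2 := by omega
      rw [hx0] at h2 ⊢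
      rw [h0 hi]
      simpa using h2
  have hSB : ∀ i ≤ n / 2, 0 < (-1 : ℝ) ^ i * ((-1) ^ n * p.eval (-x i)) := by
    intro i hi
    rcases eq_or_lt_of_le hi with rfl | hi'
    · rcases lt_or_ge (n / 2) ((n + 1) / 2) with hodd | heven
      · have h1 := hSp _ hodd
        rw [hx0] at h1 ⊢
        have hn1 : (-1 : ℝ) ^ n = -1 := Odd.neg_one_pow (Nat.odd_iff.mpr (by omega))
        rw [hn1, neg_zero]
        rw [pow_succ] at h1
        linarith
      · have h1 := hB (x (n / 2))
        rw [show 2 * ((n + 1) / 2) - n = 0 by omega, pow_zero, one_mul, hx0] at h1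
        rw [hx0, h1, zero_mul, sub_zero]
        have h2 := hFsign (n / 2) (by omega) 0 (fun j hj => by
          have := hxpos j hj
          rw [zero_pow two_ne_zero]
          positivity) (fun j hj hj' => absurd hj (by omega))
        exact h2
    · obtain ⟨h1, h2⟩ := hFG i (by omega)
      have h3 := hB (x i)
      rw [h1, zero_sub] at h3
      have h4 := mul_pos (hxpos i hi') h2
      rw [pow_succ, show x i * ((-1) ^ i * -1 * G.eval (x i ^ 2)) =
        (-1) ^ i * -(x i * G.eval (x i ^ 2)) by ring, ← h3, mul_left_comm] at h4
      exact (pos_iff_pos_of_mul_pos h4).mp (pow_pos (hxpos i hi') _)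
  have hy : ∀ i, ∃ y, i < n / 2 → x (i + 1) < y ∧ y < x i ∧ p.eval (-y) = 0 := by
    intro i
    by_cases hi : i < n / 2
    · obtain ⟨c, h1, h2, h3⟩ := exists_zero_of_sign_change
        (f := fun y => (-1) ^ n * p.eval (-y)) (by fun_prop) (hx i hi) i (hSB (i + 1) hi)
        (hSB i hi.le)
      exact ⟨c, fun _ => ⟨h1, h2, by simpa using h3⟩⟩
    · exact ⟨0, fun h => absurd h hi⟩
  choose y hy using hy
  have hSpy : ∀ i < n / 2, 0 < (-1 : ℝ) ^ (i + 1) * p.eval (y i) := by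
    intro i hi
    obtain ⟨h1, h2, h3⟩ := hy i hi
    have hy0 : 0 < y i := (hxnonneg (i + 1) hi).trans_lt h1
    have h4 := hFsign (i + 1) (by omega) (y i) (fun j hj => by
        refine pow_lt_pow_left₀ (h2.trans_le ?_) hy0.le two_ne_zero
        rcases eq_or_lt_of_le (Nat.lt_succ_iff.mp hj) with rfl | hj
        · exact le_rfl
        · exact (hxanti j i hj hi.le).le)
      (fun j hj hj' => by
        refine pow_lt_pow_left₀ (lt_of_le_of_lt ?_ h1) (hxnonneg j (by omega)) two_ne_zero
        rcases eq_or_lt_of_le hj with rfl | hj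
        · exact le_rfl
        · exact (hxanti _ j hj (by omega)).le)
    have h5 := hA (y i)
    have h6 := hB (y i)
    rw [h3, mul_zero, mul_zero] at h6
    have h7 : y i ^ (2 * ((n + 1) / 2) - n) * p.eval (y i) = 2 * F.eval (y i ^ 2) := by linarith
    have h8 : 0 < y i ^ (2 * ((n + 1) / 2) - n) * ((-1) ^ (i + 1) * p.eval (y i)) := by
      rw [mul_left_comm, h7]
      linarith
    exact (pos_iff_pos_of_mul_pos h8).mp (pow_pos hy0 _)
  have hz : ∀ i, ∃ z, i < (n + 1) / 2 → x i < z ∧ (∀ j, i = j + 1 → z < y j) ∧ p.eval z = 0 := by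
    intro i
    by_cases hi : i < (n + 1) / 2
    · rcases i with _ | i
      · have htop : Filter.Tendsto (fun t => p.eval t) Filter.atTop Filter.atTop :=
          p.tendsto_atTop_of_leadingCoeff_nonneg
            (by rw [degree_eq_natDegree (leadingCoeff_ne_zero.mp hlead.ne')]
                exact_mod_cast (by omega : 0 < p.natDegree)) hlead.le
        obtain ⟨b, hb1, hb2⟩ :=
          ((htop.eventually_gt_atTop 0).and (Filter.eventually_gt_atTop (x 0))).exists
        obtain ⟨c, h1, h2, h3⟩ := exists_zero_of_sign_change (f := fun t => p.eval t)
          (by fun_prop) hb2 0 (hSp 0 hi) (by simpa using hb1)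
        exact ⟨c, fun _ => ⟨h1, fun j hj => absurd hj (by omega), h3⟩⟩
      · obtain ⟨c, h1, h2, h3⟩ := exists_zero_of_sign_change (f := fun t => p.eval t)
          (by fun_prop) (hy i (by omega)).1 (i + 1) (hSp (i + 1) hi) (hSpy i (by omega))
        refine ⟨c, fun _ => ⟨h1, fun j hj => ?_, h3⟩⟩
        obtain rfl : i = j := by omega
        exact h2
    · exact ⟨0, fun h => absurd h hi⟩
  choose z hz using hz
  set V : ℕ → ℝ := fun k => if Even k then z (k / 2) else y (k / 2) with hV
  have hVe : ∀ i, V (2 * i) = z i := by intro i; simp [hV]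
  have hVo : ∀ i, V (2 * i + 1) = y i := by
    intro i
    simp only [hV]
    rw [if_neg (by simp), show (2 * i + 1) / 2 = i by omega]
  have hVanti : ∀ k, k + 1 < n → V (k + 1) < V k := by
    intro k hk
    rcases Nat.even_or_odd' k with ⟨i, rfl | rfl⟩
    · rw [hVe, hVo]
      exact (hy i (by omega)).2.1.trans (hz i (by omega)).1
    · rw [hVo, show 2 * i + 1 + 1 = 2 * (i + 1) by ring, hVe]
      exact (hz (i + 1) (by omega)).2.1 i rfl
  have hVpos : ∀ k < n, 0 < V k := by
    intro k hk
    rcases Nat.even_or_odd' k with ⟨i, rfl | rfl⟩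
    · rw [hVe]
      exact (hxnonneg i (by omega)).trans_lt (hz i (by omega)).1
    · rw [hVo]
      exact (hxnonneg (i + 1) (by omega)).trans_lt (hy i (by omega)).1
  have hVV : ∀ k, (-1 : ℝ) ^ k * ((-1) ^ k * V k) = V k := by
    intro k
    rw [← mul_assoc, ← mul_pow]
    simp
  have hroot : ∀ k < n, p.eval ((-1) ^ k * V k) = 0 := by
    intro k hk
    rcases Nat.even_or_odd' k with ⟨i, rfl | rfl⟩
    · rw [hVe, pow_mul, neg_one_sq, one_pow, one_mul]
      exact (hz i (by omega)).2.2
    · rw [hVo, pow_succ, pow_mul, neg_one_sq, one_pow, one_mul, neg_one_mul]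
      exact (hy i (by omega)).2.2
  have hlaminj : Set.InjOn (fun k => (-1 : ℝ) ^ k * V k) (Finset.range n) := by
    intro i hi j hj hij
    simp only [Finset.coe_range, Set.mem_Iio] at hi hj
    have habs : V i = V j := by
      have h1 := congrArg abs hij
      simpa [abs_mul, abs_of_pos (hVpos i hi), abs_of_pos (hVpos j hj)] using h1
    by_contra hne
    rcases lt_or_gt_of_ne hne with h | h
    · exact (lt_of_succ_lt_of_lt hVanti h hj).ne' habs
    · exact (lt_of_succ_lt_of_lt hVanti h hi).ne habs
  have hp := eq_C_mul_prod_of_roots hlead.ne' hdeg rfl hlaminj hroot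
  subst hdeg
  refine ⟨fun i => (-1) ^ (i : ℕ) * V i, ?_, fun i j hij => ?_, fun i => ?_⟩
  · rw [Fin.prod_univ_eq_prod_range (fun i => X - C ((-1) ^ i * V i)) p.natDegree]
    exact hp
  · simp only [hVV]
    exact lt_of_succ_lt_of_lt hVanti hij j.2
  · simp only [hVV]
    exact hVpos i i.2

end EvenOddParts

theorem exists_convolution_eq {φ : ℕ → ℝ} (hφ : φ 0 ≠ 0) (γ : ℕ → ℝ) :
    ∃ s : ℕ → ℝ, ∀ m, ∑ k ∈ Finset.range (m + 1), s k * φ (m - k) = γ m := by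
  have h : PowerSeries.mk γ * (PowerSeries.mk φ)⁻¹ * PowerSeries.mk φ = PowerSeries.mk γ := by
    rw [mul_assoc, PowerSeries.inv_mul_cancel, mul_one]
    rwa [← PowerSeries.coeff_zero_eq_constantCoeff_apply, PowerSeries.coeff_mk]
  refine ⟨fun k => PowerSeries.coeff k (PowerSeries.mk γ * (PowerSeries.mk φ)⁻¹), fun m => ?_⟩
  have h1 := congrArg (PowerSeries.coeff m) h
  rw [PowerSeries.coeff_mul, Finset.Nat.sum_antidiagonal_eq_sum_range_succ_mk,
    PowerSeries.coeff_mk] at h1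
  simpa only [PowerSeries.coeff_mk] using h1

section Coefficients

variable (p : ℝ[X])

theorem aCoeff_natCast (m : ℕ) :
    aCoeff p m = if m ≤ p.natDegree then p.coeff (p.natDegree - m) else 0 := by
  simp [aCoeff]

/-- The coefficients `a 0, a 2, a 4, …` of a polynomial, in descending order of the powers. -/
noncomputable def evenCoeff (k : ℕ) : ℝ := aCoeff p ((2 * k : ℕ) : ℤ)

/-- The coefficients `a 1, a 3, a 5, …` of a polynomial, in descending order of the powers. -/
noncomputable def oddCoeff (k : ℕ) : ℝ := aCoeff p ((2 * k + 1 : ℕ) : ℤ)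

theorem evenCoeff_of_le {k : ℕ} (hk : 2 * k ≤ p.natDegree) :
    evenCoeff p k = p.coeff (p.natDegree - 2 * k) := by
  rw [evenCoeff, aCoeff_natCast, if_pos hk]

theorem evenCoeff_of_lt {k : ℕ} (hk : p.natDegree < 2 * k) : evenCoeff p k = 0 := by
  rw [evenCoeff, aCoeff_natCast, if_neg hk.not_ge]

theorem oddCoeff_of_lt {k : ℕ} (hk : p.natDegree < 2 * k + 1) : oddCoeff p k = 0 := by
  rw [oddCoeff, aCoeff_natCast, if_neg hk.not_ge]

theorem evenCoeff_zero : evenCoeff p 0 = p.leadingCoeff :=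
  evenCoeff_of_le p (Nat.zero_le _)

theorem hurwitzMinor_eq_hankel {s : ℕ → ℝ}
    (hs : ∀ m, ∑ k ∈ Finset.range (m + 1), s k * evenCoeff p (m - k) = oddCoeff p m) (k : ℕ) :
    hurwitzMinor p (k + 1 + k) = p.leadingCoeff ^ (k + 1 + k) *
      Matrix.det (Matrix.of fun i c : Fin (k + 1) => s (i + c)) := by
  rw [← evenCoeff_zero]
  refine det_hurwitz_eq_hankel s _ _ hs k
    (fun i c => aCoeff p (2 * ((c : ℤ) + 1) - ((i : ℤ) + 1))) (fun r c => ?_) (fun r c => ?_)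
  · split_ifs with h
    · rw [oddCoeff]
      congr 1
      omega
    · rw [aCoeff, if_neg (by omega)]
  · split_ifs with h
    · rw [evenCoeff]
      congr 1
      omega
    · rw [aCoeff, if_neg (by omega)]

theorem pow_mul_eval_eq_sum {M : ℕ} (hM : p.natDegree ≤ M) (x : ℝ) :
    x ^ (M - p.natDegree) * p.eval x =
      ∑ m ∈ Finset.range (M + 1), aCoeff p (m : ℤ) * x ^ (M - m) := by
  rw [eval_eq_sum_range, ← Finset.sum_range_reflect, Finset.mul_sum]
  refine Finset.sum_subset_zero_on_sdiff (Finset.range_mono (by omega)) (fun m hm => ?_)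
    (fun m hm => ?_)
  · simp only [Finset.mem_sdiff, Finset.mem_range] at hm
    rw [aCoeff_natCast, if_neg (by omega), zero_mul]
  · simp only [Finset.mem_range] at hm
    rw [aCoeff_natCast, if_pos (by omega), show p.natDegree + 1 - 1 - m = p.natDegree - m by omega,
      mul_left_comm, ← pow_add]
    congr 2
    omega

theorem sum_range_two_mul_add_one (f : ℕ → ℝ) (N : ℕ) :
    ∑ m ∈ Finset.range (2 * N + 1), f m =
      ∑ k ∈ Finset.range (N + 1), f (2 * k) + ∑ k ∈ Finset.range N, f (2 * k + 1) := by
  induction N with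
  | zero => simp
  | succ N ih =>
    rw [show 2 * (N + 1) + 1 = 2 * N + 1 + 1 + 1 by ring, Finset.sum_range_succ,
      Finset.sum_range_succ, ih, Finset.sum_range_succ _ (N + 1),
      Finset.sum_range_succ (fun k => f (2 * k + 1)) N, show 2 * N + 1 + 1 = 2 * (N + 1) by ring]
    ring

theorem pow_mul_eval_eq_descPoly {N : ℕ} (hN : p.natDegree ≤ 2 * (N + 1)) (x : ℝ) :
    x ^ (2 * (N + 1) - p.natDegree) * p.eval x =
      (descPoly (evenCoeff p) (N + 1)).eval (x ^ 2) +
        x * (descPoly (oddCoeff p) N).eval (x ^ 2) := by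
  rw [pow_mul_eval_eq_sum p hN, sum_range_two_mul_add_one, eval_descPoly, eval_descPoly,
    Finset.mul_sum]
  congr 1
  · refine Finset.sum_congr rfl fun k hk => ?_
    rw [evenCoeff, ← pow_mul, Nat.mul_sub]
  · refine Finset.sum_congr rfl fun k hk => ?_
    simp only [Finset.mem_range] at hk
    rw [oddCoeff, ← pow_mul, mul_left_comm, ← pow_succ']
    congr 2
    omega

end Coefficients

theorem posDef_neg_hankel_iff (s : ℕ → ℝ) (N : ℕ) :
    (Matrix.of fun i j : Fin N => -s (i + j)).PosDef ↔
      ∀ Q : ℝ[X], Q ≠ 0 → Q.natDegree < N → momentFunctional s (Q * Q) < 0 := by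
  have hform : ∀ v : ℕ → ℝ, momentFunctional s ((∑ i ∈ Finset.range N, monomial i (v i)) *
      ∑ i ∈ Finset.range N, monomial i (v i)) =
      -(star (fun i : Fin N => v i) ⬝ᵥ
        (Matrix.of fun i j : Fin N => -s (i + j)).mulVec fun i : Fin N => v i) := by
    intro v
    rw [Finset.sum_mul_sum]
    simp only [map_sum, monomial_mul_monomial, momentFunctional_monomial, Finset.sum_range,
      dotProduct, Matrix.mulVec, Matrix.of_apply]
    simp only [Finset.mul_sum, ← Finset.sum_neg_distrib]
    refine Finset.sum_congr rfl fun i _ => Finset.sum_congr rfl fun j _ => ?_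
    simp
    ring
  constructor
  · intro h Q hQ0 hQ
    have h1 := hform Q.coeff
    rw [← Q.as_sum_range' N hQ] at h1
    rw [h1, neg_lt_zero]
    refine h.dotProduct_mulVec_pos fun h0 => hQ0 ?_
    ext i
    rcases lt_or_ge i N with hi | hi
    · exact congrFun h0 ⟨i, hi⟩
    · exact coeff_eq_zero_of_natDegree_lt (by omega)
  · intro h
    refine Matrix.PosDef.of_dotProduct_mulVec_pos ?_ fun v hv => ?_
    · ext i j
      simp [add_comm]
    · set w : ℕ → ℝ := fun i => if h : i < N then v ⟨i, h⟩ else 0 with hw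
      have hwv : (fun i : Fin N => w i) = v := by
        ext i
        simp [hw]
      have h1 := hform w
      rw [hwv] at h1
      have hcoeff : ∀ i : Fin N, (∑ i ∈ Finset.range N, monomial i (w i)).coeff i = v i := by
        intro i
        rw [finsetSum_coeff, Finset.sum_eq_single (i : ℕ)]
        · simp [hw]
        · intro j _ hji
          rw [coeff_monomial, if_neg hji]
        · intro hi
          exact absurd (Finset.mem_range.mpr i.2) hi
      have hQ0 : ∑ i ∈ Finset.range N, monomial i (w i) ≠ 0 := by
        intro h0
        refine hv (funext fun i => ?_)
        rw [← hcoeff i, h0]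
        simp
      have hN : N ≠ 0 := by
        rintro rfl
        exact hQ0 (by simp)
      have h2 := h _ hQ0 (by
        refine Nat.lt_of_le_pred (Nat.pos_of_ne_zero hN)
          (natDegree_sum_le_of_forall_le _ _ fun i hi => (natDegree_monomial_le _).trans ?_)
        simp only [Finset.mem_range] at hi
        exact Nat.le_pred_of_lt hi)
      linarith

theorem hurwitzMinor_sign_iff {p : ℝ[X]} (hlead : 0 < p.leadingCoeff) {s : ℕ → ℝ}
    (hs : ∀ m, ∑ k ∈ Finset.range (m + 1), s k * evenCoeff p (m - k) = oddCoeff p m) (N : ℕ) :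
    (∀ j, 1 ≤ j → j ≤ N → 0 < (-1 : ℝ) ^ j * hurwitzMinor p (2 * j - 1)) ↔
      ∀ Q : ℝ[X], Q ≠ 0 → Q.natDegree < N → momentFunctional s (Q * Q) < 0 := by
  rw [← posDef_neg_hankel_iff]
  have key : ∀ k, (-1 : ℝ) ^ (k + 1) * hurwitzMinor p (2 * (k + 1) - 1) =
      p.leadingCoeff ^ (k + 1 + k) *
        Matrix.det (Matrix.of fun i j : Fin (k + 1) => -s (i + j)) := by
    intro k
    rw [show 2 * (k + 1) - 1 = k + 1 + k by omega, hurwitzMinor_eq_hankel p hs, mul_left_comm]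
    congr 1
    have h1 : (Matrix.of fun i j : Fin (k + 1) => -s (i + j)) =
        -(Matrix.of fun i j : Fin (k + 1) => s (i + j)) := by
      ext i j
      simp
    rw [h1, Matrix.det_neg, Fintype.card_fin]
  constructor
  · intro h
    refine posDef_of_forall_det_pos (fun i j => -s (i + j)) (fun i j => by rw [add_comm]) N ?_
    rintro (_ | k) hk
    · simp
    · have h1 := h (k + 1) (by omega) hk
      rw [key] at h1
      exact (pos_iff_pos_of_mul_pos h1).mp (pow_pos hlead _)
  · rintro h (_ | k) hj hjN
    · omega
    · rw [key]
      refine mul_pos (pow_pos hlead _) ?_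
      exact (h.submatrix (e := Fin.castLE hjN) (Fin.castLE_injective hjN)).det_pos

theorem coeff_prod_X_sub_C_sign {u : ℕ → ℝ} {m : ℕ} (hu : ∀ i < m, 0 < u i) {j : ℕ} (hj : j ≤ m) :
    0 < (-1 : ℝ) ^ j * (∏ i ∈ Finset.range m, (X - C (u i))).coeff (m - j) := by
  induction m generalizing j with
  | zero =>
    obtain rfl : j = 0 := by omega
    simp
  | succ m ih =>
    have hm : (∏ i ∈ Finset.range m, (X - C (u i))).natDegree = m := by
      rw [natDegree_prod_of_monic _ _ fun i _ => monic_X_sub_C _]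
      simp
    have ih' := fun {j : ℕ} => @ih (fun i hi => hu i (by omega)) j
    rw [Finset.prod_range_succ, mul_sub, coeff_sub, coeff_mul_C]
    rcases j with _ | j
    · rw [Nat.sub_zero, coeff_mul_X,
        coeff_eq_zero_of_natDegree_lt (n := m + 1) (by omega), zero_mul, sub_zero]
      exact ih' (Nat.zero_le m)
    · have h2 := mul_pos (ih' (j := j) (by omega)) (hu m (by omega))
      rw [Nat.add_sub_add_right]
      rcases eq_or_lt_of_le hj with hjm | hjm
      · obtain rfl : j = m := by omega
        rw [Nat.sub_self] at h2 ⊢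
        rw [mul_coeff_zero, coeff_X_zero, pow_succ]
        linarith
      · have h1 := ih' (j := j + 1) (by omega)
        rw [show m - j = m - (j + 1) + 1 by omega] at h2 ⊢
        rw [coeff_mul_X]
        rw [pow_succ] at h1 ⊢
        linarith

theorem prod_erase_sub_sign {a : ℝ} (ha : 0 < a) {u : ℕ → ℝ} {N : ℕ}
    (hu : ∀ i j, i < j → j < N → u j < u i) {i : ℕ} (hi : i < N) :
    0 < (-1 : ℝ) ^ i * (a * ∏ j ∈ (Finset.range N).erase i, (u i - u j)) := by
  have h := prod_sign_pos (S := (Finset.range N).erase i) (T := Finset.range i)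
    (f := fun j => u i - u j) (fun j hj => by
      simp only [Finset.mem_erase, Finset.mem_range] at hj ⊢
      omega) (fun j hj => by
      simp only [Finset.mem_range] at hj
      exact sub_neg.mpr (hu j i hj hi)) (fun j hj hji => by
      simp only [Finset.mem_erase, Finset.mem_range] at hj hji
      exact sub_pos.mpr (hu i j (by omega) hj.2))
  rw [Finset.card_range] at h
  rw [mul_left_comm]
  exact mul_pos ha h

theorem Finset.exists_decreasing_enumeration (S : Finset ℝ) :
    ∃ u : ℕ → ℝ, (∀ i < S.card, u i ∈ S) ∧ (∀ i j, i < j → j < S.card → u j < u i) ∧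
      ∀ t ∈ S, ∃ i < S.card, u i = t := by
  set e := S.orderEmbOfFin rfl with he
  refine ⟨fun i => if h : i < S.card then e (Fin.rev ⟨i, h⟩) else 0, fun i hi => ?_,
    fun i j hij hj => ?_, fun t ht => ?_⟩
  · simp only [dif_pos hi]
    exact S.orderEmbOfFin_mem rfl _
  · simp only [dif_pos hj, dif_pos (hij.trans hj)]
    exact e.strictMono (Fin.rev_lt_rev.mpr hij)
  · obtain ⟨k, rfl⟩ : t ∈ Set.range e := by
      rw [he, S.range_orderEmbOfFin rfl]
      exact ht
    refine ⟨k.rev, k.rev.2, ?_⟩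
    exact (dif_pos k.rev.2).trans (by rw [Fin.eta, Fin.rev_rev])

theorem coeff_alternate_of_nodes {F : ℝ[X]} {a : ℝ} {n : ℕ} {x : ℕ → ℝ} (ha : 0 < a)
    (hF : F = C a * ∏ i ∈ Finset.range ((n + 1) / 2), (X - C (x i ^ 2))) (hx0 : x (n / 2) = 0)
    (hx : ∀ i < n / 2, 0 < x i) {j : ℕ} (hj : j ≤ n / 2) :
    0 < (-1 : ℝ) ^ j * F.coeff ((n + 1) / 2 - j) := by
  have h := coeff_prod_X_sub_C_sign (u := fun i => x i ^ 2) (fun i hi => pow_pos (hx i hi) 2) hj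
  rw [hF, coeff_C_mul, mul_left_comm]
  refine mul_pos ha ?_
  rcases Nat.even_or_odd' n with ⟨m, rfl | rfl⟩
  · rwa [show (2 * m + 1) / 2 = 2 * m / 2 by omega]
  · rw [show (2 * m + 1 + 1) / 2 = (2 * m + 1) / 2 + 1 by omega, Finset.prod_range_succ, hx0,
      zero_pow two_ne_zero, C_0, sub_zero, Nat.sub_add_comm hj, coeff_mul_X]
    exact h

/-- The roots of a polynomial with alternating coefficients are nonnegative. -/
theorem nonneg_of_eval_descPoly_eq_zero {φ : ℕ → ℝ} {N : ℕ} (hφ0 : 0 < φ 0)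
    (hφ : ∀ k ≤ N, 0 ≤ (-1 : ℝ) ^ k * φ k) {t : ℝ} (ht : (descPoly φ N).eval t = 0) : 0 ≤ t := by
  by_contra! hneg
  have h1 : (-1) ^ N * (descPoly φ N).eval t =
      ∑ k ∈ Finset.range (N + 1), ((-1) ^ k * φ k) * (-t) ^ (N - k) := by
    rw [eval_descPoly, Finset.mul_sum]
    refine Finset.sum_congr rfl fun k hk => ?_
    simp only [Finset.mem_range] at hk
    obtain ⟨d, rfl⟩ := Nat.exists_eq_add_of_le (Nat.lt_succ_iff.mp hk)
    rw [Nat.add_sub_cancel_left, neg_pow t, pow_add]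
    ring
  have h2 : 0 < ∑ k ∈ Finset.range (N + 1), ((-1) ^ k * φ k) * (-t) ^ (N - k) := by
    refine Finset.sum_pos' (fun k hk => ?_) ⟨0, by simp, ?_⟩
    · simp only [Finset.mem_range] at hk
      exact mul_nonneg (hφ k (by omega)) (pow_nonneg (by linarith) _)
    · rw [pow_zero, one_mul]
      exact mul_pos hφ0 (pow_pos (by linarith) _)
  rw [← h1, ht, mul_zero] at h2
  exact lt_irrefl _ h2

section Criterion

variable {F G : ℝ[X]} {N : ℕ} (L : ℝ[X] →ₗ[ℝ] ℝ)

theorem neg_one_pow_mul_neg_one_pow_succ (i : ℕ) : (-1 : ℝ) ^ i * (-1) ^ (i + 1) = -1 := by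
  rw [← pow_add, ← add_assoc, ← two_mul, neg_one_pow_two_mul_add_one]

theorem injOn_of_lt_of_lt {u : ℕ → ℝ} (hu : ∀ i j, i < j → j < N → u j < u i) :
    Set.InjOn u (Finset.range N) := by
  intro i hi j hj hij
  simp only [Finset.coe_range, Set.mem_Iio] at hi hj
  by_contra hne
  rcases lt_or_gt_of_ne hne with h | h
  · exact (hu i j h hj).ne' hij
  · exact (hu j i h hi).ne hij

theorem map_mul_self_neg_of_alternating (hFdeg : F.natDegree = N) (hFlead : 0 < F.leadingCoeff)
    (hL : ∀ t q, F = (X - C t) * q → ∀ h, L (h * q) = h.eval t * G.eval t) {u : ℕ → ℝ}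
    (hu : ∀ i j, i < j → j < N → u j < u i)
    (hFG : ∀ i < N, F.eval (u i) = 0 ∧ 0 < (-1 : ℝ) ^ (i + 1) * G.eval (u i)) :
    ∀ Q : ℝ[X], Q ≠ 0 → Q.natDegree < N → L (Q * Q) < 0 := by
  intro Q hQ0 hQ
  have hF := eq_C_mul_prod_of_roots hFlead.ne' hFdeg rfl (injOn_of_lt_of_lt hu)
    fun i hi => (hFG i hi).1
  refine map_mul_self_neg_of_weights L (injOn_of_lt_of_lt hu) hF hL (fun i hi => ?_) hQ0
    ((natDegree_lt_iff_degree_lt hQ0).mp hQ)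
  have h1 := mul_pos (prod_erase_sub_sign hFlead hu hi) (hFG i hi).2
  rwa [mul_mul_mul_comm, neg_one_pow_mul_neg_one_pow_succ, neg_one_mul, neg_pos] at h1

theorem exists_alternating_of_map_mul_self_neg (hFdeg : F.natDegree = N)
    (hFlead : 0 < F.leadingCoeff) (hLF : ∀ h, L (h * F) = 0)
    (hL : ∀ t q, F = (X - C t) * q → ∀ h, L (h * q) = h.eval t * G.eval t)
    (hneg : ∀ Q : ℝ[X], Q ≠ 0 → Q.natDegree < N → L (Q * Q) < 0) :
    ∃ u : ℕ → ℝ, (∀ i j, i < j → j < N → u j < u i) ∧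
      (∀ i < N, F.eval (u i) = 0 ∧ 0 < (-1 : ℝ) ^ (i + 1) * G.eval (u i)) ∧
      ∀ t, F.eval t = 0 → ∃ i < N, u i = t := by
  have hF0 : F ≠ 0 := leadingCoeff_ne_zero.mp hFlead.ne'
  have hneg' : ∀ Q : ℝ[X], Q ≠ 0 → Q.natDegree < F.natDegree → L (Q * Q) < 0 := by
    rwa [hFdeg]
  have hcard : F.roots.toFinset.card = N := by
    rw [Multiset.toFinset_card_of_nodup (nodup_roots_of_map_mul_self_neg L hF0 hLF hneg'),
      ← hFdeg, (splits_of_map_mul_self_neg L hF0 hLF hneg').natDegree_eq_card_roots]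
  obtain ⟨u, hu1, hu, hu2⟩ := F.roots.toFinset.exists_decreasing_enumeration
  rw [hcard] at hu1 hu hu2
  have hroot : ∀ t, t ∈ F.roots.toFinset ↔ F.eval t = 0 := fun t => by
    rw [Multiset.mem_toFinset, mem_roots hF0, IsRoot]
  simp only [hroot] at hu1 hu2
  refine ⟨u, hu, fun i hi => ⟨hu1 i hi, ?_⟩, hu2⟩
  have hF := eq_C_mul_prod_of_roots hFlead.ne' hFdeg rfl (injOn_of_lt_of_lt hu) hu1
  set q := C F.leadingCoeff * ∏ j ∈ (Finset.range N).erase i, (X - C (u j)) with hq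
  have hFq : F = (X - C (u i)) * q := by
    rw [hq, mul_left_comm, Finset.mul_prod_erase _ (fun j => X - C (u j)) (Finset.mem_range.mpr hi)]
    exact hF
  have hqe : q.eval (u i) = F.leadingCoeff * ∏ j ∈ (Finset.range N).erase i, (u i - u j) := by
    rw [hq, eval_mul, eval_C, eval_prod]
    simp
  have hq0 : q ≠ 0 := by
    intro h
    rw [h, mul_zero] at hFq
    exact hF0 hFq
  have h1 := hneg q hq0 (by
    have h := natDegree_mul (X_sub_C_ne_zero (u i)) hq0
    rw [← hFq, natDegree_X_sub_C] at h
    omega)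
  rw [hL _ _ hFq, hqe] at h1
  have h2 := prod_erase_sub_sign hFlead hu hi
  have h3 : 0 < ((-1) ^ i * (F.leadingCoeff * ∏ j ∈ (Finset.range N).erase i, (u i - u j))) *
      ((-1) ^ (i + 1) * G.eval (u i)) := by
    rwa [mul_mul_mul_comm, neg_one_pow_mul_neg_one_pow_succ, neg_one_mul, neg_pos]
  exact (pos_iff_pos_of_mul_pos h3).mp h2

end Criterion

/-- Analogue of the Liénard–Chipart criterion: `p` of degree `n ≥ 1` with positive leading
coefficient is self-interlacing of kind I iff `(-1)^j Δ_{2j-1}(p) > 0` for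
`j = 1, …, ⌊(n+1)/2⌋` and `(-1)^j a_{2j} > 0` for `j = 1, …, ⌊n/2⌋`. -/
theorem selfInterlacing_lienard_chipart_criterion
    (n : ℕ) (hn : 1 ≤ n) (p : Polynomial ℝ)
    (hdeg : p.natDegree = n) (hlead : 0 < p.leadingCoeff) :
    SelfInterlacingI p ↔
      ((∀ j, 1 ≤ j → j ≤ (n + 1) / 2 → 0 < (-1 : ℝ) ^ j * hurwitzMinor p (2 * j - 1)) ∧
       (∀ j, 1 ≤ j → j ≤ n / 2 → 0 < (-1 : ℝ) ^ j * p.coeff (n - 2 * j))) := by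
  subst hdeg
  set n := p.natDegree with hndef
  obtain ⟨N, hN⟩ : ∃ N, (n + 1) / 2 = N + 1 := ⟨(n + 1) / 2 - 1, by omega⟩
  have hφ0 : evenCoeff p 0 = p.leadingCoeff := evenCoeff_zero p
  have hφne : evenCoeff p 0 ≠ 0 := hφ0 ▸ hlead.ne'
  obtain ⟨s, hs⟩ := exists_convolution_eq hφne (oddCoeff p)
  set F := descPoly (evenCoeff p) (N + 1) with hFdef
  set G := descPoly (oddCoeff p) N with hGdef
  set L := momentFunctional s with hLdef
  have hφ : ∀ k, N + 1 < k → evenCoeff p k = 0 := fun k hk => evenCoeff_of_lt p (by omega)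
  have hγ : ∀ k, N + 1 ≤ k → oddCoeff p k = 0 := fun k hk => oddCoeff_of_lt p (by omega)
  have hLF : ∀ h, L (h * F) = 0 := momentFunctional_mul_descPoly hs hφ
    fun k hk => hγ k hk
  have hL : ∀ t q, F = (X - C t) * q → ∀ h, L (h * q) = h.eval t * G.eval t :=
    fun t q hq h => momentFunctional_mul_quotient hs hφ hγ hφne hq h
  have hFdeg : F.natDegree = (n + 1) / 2 := by rw [hN, hFdef, natDegree_descPoly hφne]
  have hFcoeff : ∀ k ≤ N + 1, F.coeff (N + 1 - k) = evenCoeff p k := fun k hk =>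
    coeff_descPoly _ hk
  have hFlead : 0 < F.leadingCoeff := by
    have h := hFcoeff 0 (Nat.zero_le _)
    rw [Nat.sub_zero, ← hN, ← hFdeg, coeff_natDegree] at h
    rwa [h, hφ0]
  have hA : ∀ x : ℝ, x ^ (2 * ((n + 1) / 2) - n) * p.eval x =
      F.eval (x ^ 2) + x * G.eval (x ^ 2) := by
    rw [hN]
    exact pow_mul_eval_eq_descPoly p (by omega)
  have hB : ∀ x : ℝ, x ^ (2 * ((n + 1) / 2) - n) * ((-1) ^ n * p.eval (-x)) =
      F.eval (x ^ 2) - x * G.eval (x ^ 2) := by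
    intro x
    have h := hA (-x)
    rw [neg_sq, neg_mul, ← sub_eq_add_neg, neg_pow] at h
    rw [← h]
    have hpar : (-1 : ℝ) ^ n = (-1) ^ (2 * ((n + 1) / 2) - n) := by
      rw [neg_one_pow_eq_pow_mod_two, neg_one_pow_eq_pow_mod_two (2 * ((n + 1) / 2) - n)]
      congr 1
      omega
    rw [hpar]
    ring
  have h0 : n / 2 < (n + 1) / 2 → p.eval 0 = G.eval 0 := by
    intro hodd
    rw [← coeff_zero_eq_eval_zero, ← coeff_zero_eq_eval_zero]
    have h := coeff_descPoly (oddCoeff p) (le_refl N)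
    rw [Nat.sub_self] at h
    rw [hGdef, h, oddCoeff, aCoeff_natCast, if_pos (by omega)]
    congr 1
    omega
  have hcoeff : ∀ j ≤ n / 2, p.coeff (n - 2 * j) = F.coeff ((n + 1) / 2 - j) := by
    intro j hj
    rw [hN, hFcoeff j (by omega), evenCoeff_of_le p (by omega)]
  rw [hurwitzMinor_sign_iff hlead hs]
  constructor
  · intro h
    obtain ⟨x, hx0, hx, hFG⟩ := h.exists_nodes rfl hlead hA hB h0
    have hxanti : ∀ i j, i < j → j ≤ n / 2 → x j < x i := fun i j hij hj =>
      lt_of_succ_lt_of_lt (n := n / 2 + 1) (fun k hk => hx k (by omega)) hij (by omega)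
    have hxpos : ∀ i < n / 2, 0 < x i := fun i hi => hx0 ▸ hxanti i _ hi le_rfl
    have hu : ∀ i j, i < j → j < (n + 1) / 2 → x j ^ 2 < x i ^ 2 := by
      intro i j hij hj
      refine pow_lt_pow_left₀ (hxanti i j hij (by omega)) ?_ two_ne_zero
      rcases lt_or_ge j (n / 2) with hj' | hj'
      · exact (hxpos j hj').le
      · obtain rfl : j = n / 2 := by omega
        exact hx0.ge
    refine ⟨map_mul_self_neg_of_alternating L hFdeg hFlead hL hu hFG, fun j _ hj => ?_⟩
    rw [hcoeff j hj]
    exact coeff_alternate_of_nodes hFlead (eq_C_mul_prod_of_roots hFlead.ne' hFdeg rfl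
      (injOn_of_lt_of_lt hu) fun i hi => (hFG i hi).1) hx0 hxpos hj
  · rintro ⟨hneg, hsign⟩
    obtain ⟨u, hu, hFG, huF⟩ := exists_alternating_of_map_mul_self_neg L hFdeg hFlead hLF hL hneg
    have hφsign : ∀ k ≤ n / 2, 0 < (-1 : ℝ) ^ k * evenCoeff p k := by
      rintro (_ | k) hk
      · simpa [hφ0] using hlead
      · rw [evenCoeff_of_le p (by omega)]
        exact hsign _ (by omega) hk
    have hu0 : ∀ i < (n + 1) / 2, 0 ≤ u i := by
      intro i hi
      refine nonneg_of_eval_descPoly_eq_zero (N := N + 1) (hφ0 ▸ hlead) (fun k hk => ?_)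
        (hFG i hi).1
      rcases le_or_gt k (n / 2) with hk' | hk'
      · exact (hφsign k hk').le
      · rw [evenCoeff_of_lt p (by omega), mul_zero]
    have hF0 : F.eval 0 = evenCoeff p (N + 1) := by
      rw [← coeff_zero_eq_eval_zero, ← hFcoeff _ le_rfl, Nat.sub_self]
    have hupos : ∀ i < n / 2, 0 < u i := by
      intro i hi
      rcases lt_or_ge (i + 1) ((n + 1) / 2) with hi' | hi'
      · exact (hu0 _ hi').trans_lt (hu i (i + 1) (by omega) hi')
      · refine lt_of_le_of_ne (hu0 i (by omega)) fun h => ?_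
        have h1 := (hFG i (by omega)).1
        rw [← h, hF0] at h1
        have h2 := hφsign (N + 1) (by omega)
        rw [h1, mul_zero] at h2
        exact lt_irrefl _ h2
    have hulast : n / 2 < (n + 1) / 2 → u (n / 2) = 0 := by
      intro hodd
      obtain ⟨i, hi, hi0⟩ := huF 0 (by rw [hF0, evenCoeff_of_lt p (by omega)])
      rcases lt_or_ge i (n / 2) with hi' | hi'
      · exact absurd hi0 (hupos i hi').ne'
      · rwa [show n / 2 = i by omega]
    have hsq : ∀ i < (n + 1) / 2,
        (if i < (n + 1) / 2 then Real.sqrt (u i) else 0) ^ 2 = u i := fun i hi => by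
      rw [if_pos hi, Real.sq_sqrt (hu0 i hi)]
    refine selfInterlacingI_of_nodes (x := fun i => if i < (n + 1) / 2 then Real.sqrt (u i) else 0)
      rfl hn hlead hFdeg hFlead hA hB h0 ?_ (fun i hi => ?_) (fun i hi => ?_)
    · split_ifs with h
      · rw [hulast h, Real.sqrt_zero]
      · rfl
    · rw [if_pos (show i < (n + 1) / 2 by omega)]
      split_ifs with h
      · exact Real.sqrt_lt_sqrt (hu0 _ h) (hu i (i + 1) (by omega) h)
      · exact Real.sqrt_pos.mpr (hupos i hi)
    · rw [hsq i hi]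
      exact hFG i hi
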